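/- The modified elliptic R-operator R_k(ξ) given by R_k(ξ)f(z₁,z₂) = σ_μ(z₁₂ + (μ+ξ)/k)f(z₁+μ/k, z₂−μ/k) − σ_ξ(z₁₂ + (μ+ξ)/k)f(z₂−ξ/k, z₁+ξ/k) preserves the space V_k ⊗ V_k, i.e., if f(z₁,z₂) = g(z₁)h(z₂) with g,h ∈ V_k then R_k(ξ)f, as a function of (z₁,z₂), lies in V_k ⊗ V_k. -/

import Mathlib

open Complex

/-- Jacobi theta function `θ₁(z,τ) = Σ_{n∈ℤ+1/2} exp(iπn²τ + 2πin(z+1/2))`. -/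
noncomputable def theta1 (z τ : ℂ) : ℂ :=
  ∑' n : ℤ, Complex.exp (Real.pi * I * ((n : ℂ) + 1/2)^2 * τ +
    2 * Real.pi * I * ((n : ℂ) + 1/2) * (z + 1/2))

/-- `θ₁′(0,τ)`, the derivative of `θ₁` in the first variable at `0`. -/
noncomputable def theta1'0 (τ : ℂ) : ℂ := deriv (fun w => theta1 w τ) 0

/-- The function `σ_μ(z) = θ₁(z−μ,τ)θ₁′(0,τ)/(θ₁(z,τ)θ₁(−μ,τ))`. -/
noncomputable def sigmaE (τ μ z : ℂ) : ℂ :=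
  theta1 (z - μ) τ * theta1'0 τ / (theta1 z τ * theta1 (-μ) τ)

/-- The lattice `ℤ + τℤ`. -/
def lattice (τ : ℂ) : Set ℂ := {w | ∃ m n : ℤ, w = (m : ℂ) + (n : ℂ) * τ}

/-- The space V_k of entire functions with f(z+1) = f(z) and
f(z+τ) = e^{−2πikz−πikτ} f(z). -/
def VkSet (τ : ℂ) (k : ℕ) : Set (ℂ → ℂ) :=
  {f | Differentiable ℂ f ∧ (∀ z, f (z + 1) = f z) ∧
    ∀ z, f (z + τ) = Complex.exp (-2 * Real.pi * I * k * z - Real.pi * I * k * τ) * f z}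

lemma theta1_term_eq (n : ℤ) (z τ : ℂ) :
    Complex.exp (Real.pi * I * ((n : ℂ) + 1/2)^2 * τ +
      2 * Real.pi * I * ((n : ℂ) + 1/2) * (z + 1/2)) =
    Complex.exp (Real.pi * I * (τ / 4 + z + 1 / 2)) *
      jacobiTheta₂_term n (z + 1 / 2 + τ / 2) τ := by
  rw [jacobiTheta₂_term, ← Complex.exp_add]
  congr 1
  ring

lemma theta1_eq_jacobiTheta₂ (z τ : ℂ) :
    theta1 z τ = Complex.exp (Real.pi * I * (τ / 4 + z + 1 / 2)) *
      jacobiTheta₂ (z + 1 / 2 + τ / 2) τ := by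
  simp only [theta1, theta1_term_eq, tsum_mul_left, jacobiTheta₂]

lemma differentiable_theta1 {τ : ℂ} (hτ : 0 < τ.im) : Differentiable ℂ (fun z => theta1 z τ) := by
  intro z
  simp only [theta1_eq_jacobiTheta₂]
  have := (differentiableAt_jacobiTheta₂_fst (z + 1 / 2 + τ / 2) hτ).comp z
    (f := fun z : ℂ => z + 1 / 2 + τ / 2) (by fun_prop)
  exact DifferentiableAt.mul (by fun_prop) this

lemma theta1_add_one (z τ : ℂ) : theta1 (z + 1) τ = -theta1 z τ := by
  rw [theta1_eq_jacobiTheta₂, theta1_eq_jacobiTheta₂,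
    show z + 1 + 1 / 2 + τ / 2 = (z + 1 / 2 + τ / 2) + 1 by ring, jacobiTheta₂_add_left,
    show Real.pi * I * (τ / 4 + (z + 1) + 1 / 2) =
      Real.pi * I * (τ / 4 + z + 1 / 2) + Real.pi * I by ring, Complex.exp_add, Complex.exp_pi_mul_I]
  ring

lemma theta1_add_tau (z τ : ℂ) :
    theta1 (z + τ) τ = -Complex.exp (-2 * Real.pi * I * z - Real.pi * I * τ) * theta1 z τ := by
  have key : Complex.exp (Real.pi * I * (τ / 4 + (z + τ) + 1 / 2)) *
      Complex.exp (-Real.pi * I * (τ + 2 * (z + 1 / 2 + τ / 2))) =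
      Complex.exp (Real.pi * I) * Complex.exp (-2 * Real.pi * I * z - Real.pi * I * τ) *
        Complex.exp (Real.pi * I * (τ / 4 + z + 1 / 2)) := by
    simp only [← Complex.exp_add]
    rw [Complex.exp_eq_exp_iff_exists_int]
    exact ⟨-1, by push_cast; ring⟩
  rw [Complex.exp_pi_mul_I] at key
  rw [theta1_eq_jacobiTheta₂, theta1_eq_jacobiTheta₂,
    show z + τ + 1 / 2 + τ / 2 = (z + 1 / 2 + τ / 2) + τ by ring, jacobiTheta₂_add_left']
  linear_combination jacobiTheta₂ (z + 1 / 2 + τ / 2) τ * key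

lemma theta1_neg (z τ : ℂ) : theta1 (-z) τ = -theta1 z τ := by
  have key : Complex.exp (Real.pi * I * (τ / 4 + -z + 1 / 2)) =
      Complex.exp (Real.pi * I) * Complex.exp (Real.pi * I * (τ / 4 + z + 1 / 2)) *
        Complex.exp (-Real.pi * I * (τ + 2 * (z - 1 / 2 - τ / 2))) := by
    simp only [← Complex.exp_add]
    rw [Complex.exp_eq_exp_iff_exists_int]
    exact ⟨-1, by push_cast; ring⟩
  rw [Complex.exp_pi_mul_I] at key
  rw [theta1_eq_jacobiTheta₂, theta1_eq_jacobiTheta₂,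
    show -z + 1 / 2 + τ / 2 = -(z - 1 / 2 - τ / 2) by ring, jacobiTheta₂_neg_left,
    show z + 1 / 2 + τ / 2 = (z - 1 / 2 - τ / 2) + τ + 1 by ring, jacobiTheta₂_add_left,
    jacobiTheta₂_add_left']
  linear_combination jacobiTheta₂ (z - 1 / 2 - τ / 2) τ * key

lemma exists_jacobiTheta₂_ne_zero {τ : ℂ} (hτ : 0 < τ.im) : ∃ z, jacobiTheta₂ z τ ≠ 0 := by
  by_contra! H
  have hsum : HasSum (fun n : ℤ => ∫ x in (0 : ℝ)..1, jacobiTheta₂_term n x τ)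
      (∫ x in (0 : ℝ)..1, ∑' n : ℤ, jacobiTheta₂_term n x τ) := by
    let f : ℤ → C(ℝ, ℂ) := fun n => ⟨fun x => jacobiTheta₂_term n x τ, by
      unfold jacobiTheta₂_term; fun_prop⟩
    refine intervalIntegral.hasSum_intervalIntegral_of_summable_norm (f := f) ?_
    refine Summable.of_nonneg_of_le (fun _ => norm_nonneg _) (fun n => ?_)
      ((summable_jacobiTheta₂_term_iff 0 τ).2 hτ).norm
    rw [ContinuousMap.norm_le _ (norm_nonneg _)]
    rintro ⟨x, -⟩
    simp [f, norm_jacobiTheta₂_term]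
  have hint : ∀ n : ℤ, n ≠ 0 → ∫ x in (0 : ℝ)..1, jacobiTheta₂_term n x τ = 0 := by
    intro n hn
    simp only [jacobiTheta₂_term, Complex.exp_add, intervalIntegral.integral_mul_const]
    rw [integral_exp_mul_complex (by simp [hn, Real.pi_ne_zero])]
    have : Complex.exp (2 * Real.pi * I * n) = 1 := by
      rw [Complex.exp_eq_one_iff]; exact ⟨n, by ring⟩
    simp [this]
  have h0 := hsum.unique (hasSum_single 0 hint)
  have : ∀ x : ℝ, ∑' n : ℤ, jacobiTheta₂_term n x τ = 0 := fun x => H x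
  simp only [this] at h0
  simp [jacobiTheta₂_term] at h0

lemma exists_theta1_ne_zero {τ : ℂ} (hτ : 0 < τ.im) : ∃ z, theta1 z τ ≠ 0 := by
  obtain ⟨z, hz⟩ := exists_jacobiTheta₂_ne_zero hτ
  refine ⟨z - 1 / 2 - τ / 2, ?_⟩
  rw [theta1_eq_jacobiTheta₂]
  refine mul_ne_zero (Complex.exp_ne_zero _) ?_
  convert hz using 2
  ring

/-- Splitting of `ℤ × ℤ` according to the parity of the difference of the coordinates. -/
def intProdParityEquiv : (ℤ × ℤ) ⊕ (ℤ × ℤ) ≃ ℤ × ℤ where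
  toFun := Sum.elim (fun p => (p.1 + p.2, p.1 - p.2)) (fun p => (p.1 + p.2, p.1 - p.2 - 1))
  invFun p := if 2 ∣ p.1 - p.2 then Sum.inl ((p.1 + p.2) / 2, (p.1 - p.2) / 2)
    else Sum.inr ((p.1 + p.2 + 1) / 2, (p.1 - p.2 - 1) / 2)
  left_inv := by
    rintro (⟨r, s⟩ | ⟨r, s⟩)
    · have : (2 : ℤ) ∣ r + s - (r - s) := by omega
      simp only [Sum.elim_inl, this, if_true]
      congr 2 <;> omega
    · have : ¬ (2 : ℤ) ∣ r + s - (r - s - 1) := by omega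
      simp only [Sum.elim_inr, this, if_false]
      congr 2 <;> omega
  right_inv := by
    rintro ⟨m, n⟩
    by_cases h : (2 : ℤ) ∣ m - n
    · simp only [h, if_true, Sum.elim_inl, Prod.mk.injEq]
      omega
    · simp only [h, if_false, Sum.elim_inr, Prod.mk.injEq]
      omega

lemma theta1_mul_theta1 {τ : ℂ} (hτ : 0 < τ.im) : ∃ E O : ℂ → ℂ, ∀ x y,
    theta1 (x + y) τ * theta1 (x - y) τ = E x * O y - O x * E y := by
  have hτ2 : 0 < (2 * τ).im := by simpa using hτ
  let a : ℂ → ℤ → ℂ := fun z n => Complex.exp (Real.pi * I * ((n : ℂ) + 1/2)^2 * τ +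
    2 * Real.pi * I * ((n : ℂ) + 1/2) * (z + 1/2))
  let e : ℂ → ℤ → ℂ := fun x r => Complex.exp (2 * Real.pi * I * τ * r ^ 2 + 4 * Real.pi * I * r * x)
  let o : ℂ → ℤ → ℂ := fun x r =>
    Complex.exp (2 * Real.pi * I * τ * (r + 1 / 2) ^ 2 + 4 * Real.pi * I * (r + 1 / 2) * x)
  have ha : ∀ z, Summable fun n => ‖a z n‖ := fun z => by
    simp only [a, theta1_term_eq]
    exact (((summable_jacobiTheta₂_term_iff _ τ).2 hτ).mul_left _).norm
  have he : ∀ x, Summable fun n => ‖e x n‖ := fun x => by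
    have := ((summable_jacobiTheta₂_term_iff (2 * x) (2 * τ)).2 hτ2).norm
    refine this.congr fun n => ?_
    simp only [e, jacobiTheta₂_term]
    congr 2; ring
  have ho : ∀ x, Summable fun n => ‖o x n‖ := fun x => by
    have := (((summable_jacobiTheta₂_term_iff (2 * x + τ) (2 * τ)).2 hτ2).mul_left
      (Complex.exp (Real.pi * I * τ / 2 + 2 * Real.pi * I * x))).norm
    refine this.congr fun n => ?_
    simp only [o, jacobiTheta₂_term, ← Complex.exp_add]
    congr 2; ring
  refine ⟨fun x => ∑' r, e x r, fun x => ∑' r, o x r, fun x y => ?_⟩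
  have h1 : HasSum (fun p : ℤ × ℤ => a (x + y) p.1 * a (x - y) p.2)
      (theta1 (x + y) τ * theta1 (x - y) τ) := by
    have := (summable_mul_of_summable_norm (ha (x + y)) (ha (x - y))).hasSum
    rwa [← tsum_mul_tsum_of_summable_norm (ha (x + y)) (ha (x - y))] at this
  have h2 : HasSum (fun p : ℤ × ℤ => -(o x p.1 * e y p.2)) (-((∑' r, o x r) * ∑' r, e y r)) := by
    rw [tsum_mul_tsum_of_summable_norm (ho x) (he y)]
    exact (summable_mul_of_summable_norm (ho x) (he y)).hasSum.neg
  have h3 : HasSum (fun p : ℤ × ℤ => e x p.1 * o y p.2) ((∑' r, e x r) * ∑' r, o y r) := by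
    rw [tsum_mul_tsum_of_summable_norm (he x) (ho y)]
    exact (summable_mul_of_summable_norm (he x) (ho y)).hasSum
  rw [← intProdParityEquiv.hasSum_iff] at h1
  refine (h1.unique ((HasSum.sum (f := _ ∘ _) (h2.congr_fun ?_) (h3.congr_fun ?_)))).trans ?_
  · rintro ⟨r, s⟩
    have key : Complex.exp (Real.pi * I * ((r + s : ℂ) + 1/2)^2 * τ +
          2 * Real.pi * I * ((r + s : ℂ) + 1/2) * (x + y + 1/2)) *
        Complex.exp (Real.pi * I * ((r - s : ℂ) + 1/2)^2 * τ +
          2 * Real.pi * I * ((r - s : ℂ) + 1/2) * (x - y + 1/2)) =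
        Complex.exp (Real.pi * I) * (o x r * e y s) := by
      simp only [e, o, ← Complex.exp_add]
      rw [Complex.exp_eq_exp_iff_exists_int]
      exact ⟨r, by ring⟩
    rw [Complex.exp_pi_mul_I, neg_one_mul] at key
    simpa [intProdParityEquiv, a] using key
  · rintro ⟨r, s⟩
    have key : Complex.exp (Real.pi * I * ((r + s : ℂ) + 1/2)^2 * τ +
          2 * Real.pi * I * ((r + s : ℂ) + 1/2) * (x + y + 1/2)) *
        Complex.exp (Real.pi * I * ((r - s - 1 : ℂ) + 1/2)^2 * τ +
          2 * Real.pi * I * ((r - s - 1 : ℂ) + 1/2) * (x - y + 1/2)) =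
        e x r * o y s := by
      simp only [e, o, ← Complex.exp_add]
      rw [Complex.exp_eq_exp_iff_exists_int]
      exact ⟨r, by ring⟩
    simpa [intProdParityEquiv, a] using key
  · ring

lemma exists_theta1_mul_theta1_add_ne_zero {τ : ℂ} (hτ : 0 < τ.im) (w : ℂ) :
    ∃ v, theta1 v τ ≠ 0 ∧ theta1 (v + w) τ ≠ 0 := by
  have hB := differentiable_theta1 hτ
  obtain ⟨z₀, hz₀⟩ := exists_theta1_ne_zero hτ
  have hBan : AnalyticOnNhd ℂ (fun z => theta1 z τ) Set.univ :=
    fun z _ => hB.analyticAt z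
  have h1 : ∀ᶠ z in nhdsWithin z₀ {z₀}ᶜ, theta1 z τ ≠ 0 :=
    (hB.continuous.continuousAt.eventually_ne hz₀).filter_mono nhdsWithin_le_nhds
  have h2 : ∃ᶠ z in nhdsWithin z₀ {z₀}ᶜ, theta1 (z + w) τ ≠ 0 := by
    have hA : Differentiable ℂ (fun z => theta1 (z + w) τ) := hB.comp (by fun_prop)
    intro hev
    have h0 := AnalyticOnNhd.eq_of_frequently_eq (f := fun z => theta1 (z + w) τ) (g := fun _ => 0)
      (z₀ := z₀) (fun z _ => hA.analyticAt z) (fun z _ => analyticAt_const)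
      (hev.mono fun z hz => not_not.1 hz).frequently
    have := congrFun h0 (z₀ - w)
    simp [hz₀] at this
  obtain ⟨v, hv⟩ := (h2.and_eventually h1).exists
  exact ⟨v, hv.2, hv.1⟩

/-- If the logarithmic derivatives of two entire functions differ by a constant `c`, then
`A = K e^{cz} B`. -/
lemma exists_mul_exp_eq_of_deriv_mul_sub {A B : ℂ → ℂ} (hA : Differentiable ℂ A)
    (hB : Differentiable ℂ B) {c v : ℂ} (hv : B v ≠ 0)
    (h : ∀ u, deriv A u * B u - A u * deriv B u = c * A u * B u) :
    ∃ K, ∀ u, A u * Complex.exp (-c * u) = K * B u := by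
  let q : ℂ → ℂ := fun u => A u * Complex.exp (-c * u) / B u
  obtain ⟨r, hr, hball⟩ := Metric.eventually_nhds_iff_ball.1
    (hB.continuous.continuousAt.eventually_ne hv)
  have hq : ∀ u ∈ Metric.ball v r, HasDerivAt q 0 u := by
    intro u hu
    have hE : HasDerivAt (fun u => Complex.exp (-c * u)) (Complex.exp (-c * u) * (-c)) u := by
      simpa using ((hasDerivAt_id u).const_mul (-c)).cexp
    have := ((hA u).hasDerivAt.mul hE).div (hB u).hasDerivAt (hball u hu)
    refine this.congr_deriv ?_
    rw [div_eq_zero_iff]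
    left
    simp only [Pi.mul_apply]
    linear_combination Complex.exp (-c * u) * h u
  have hconst : ∀ u ∈ Metric.ball v r, q u = q v := by
    intro u hu
    exact (Metric.isOpen_ball).is_const_of_deriv_eq_zero (convex_ball v r).isPreconnected
      (fun x hx => (hq x hx).differentiableAt.differentiableWithinAt)
      (fun x hx => (hq x hx).deriv) hu (Metric.mem_ball_self hr)
  refine ⟨q v, fun u => ?_⟩
  have hAE : Differentiable ℂ (fun u => A u * Complex.exp (-c * u)) := by fun_prop
  have hKB : Differentiable ℂ (fun u => q v * B u) := by fun_prop
  refine congrFun (AnalyticOnNhd.eq_of_eventuallyEq (z₀ := v) (fun z _ => hAE.analyticAt z)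
    (fun z _ => hKB.analyticAt z) ?_) u
  filter_upwards [Metric.ball_mem_nhds v hr] with x hx
  rw [← hconst x hx]
  exact (div_mul_cancel₀ _ (hball x hx)).symm

/-- The zeros of `θ₁` lie in the lattice. -/
lemma mem_lattice_of_theta1_eq_zero {τ : ℂ} (hτ : 0 < τ.im) {w : ℂ} (hw : theta1 w τ = 0) :
    w ∈ lattice τ := by
  obtain ⟨E, O, hEO⟩ := theta1_mul_theta1 hτ
  have hprop : ∀ x, E x * O (x + w) = O x * E (x + w) := by
    intro x
    have := hEO x (x + w)
    rw [show x - (x + w) = -w by ring, theta1_neg, hw] at this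
    linear_combination -this
  let A : ℂ → ℂ := fun u => theta1 (u + w) τ
  let B : ℂ → ℂ := fun u => theta1 u τ
  have hB : Differentiable ℂ B := differentiable_theta1 hτ
  have hA : Differentiable ℂ A := hB.comp (by fun_prop : Differentiable ℂ fun u : ℂ => u + w)
  have hfun : ∀ u v s, A u * A v * (B (u + s) * B (v - s)) =
      A (u + s) * A (v - s) * (B u * B v) := by
    intro u v s
    have e1 := hEO ((u + v) / 2 + w) ((u - v) / 2)
    have e2 := hEO ((u + v) / 2) ((u - v) / 2 + s)
    have e3 := hEO ((u + v) / 2 + w) ((u - v) / 2 + s)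
    have e4 := hEO ((u + v) / 2) ((u - v) / 2)
    rw [show (u + v) / 2 + w + (u - v) / 2 = u + w by ring,
      show (u + v) / 2 + w - (u - v) / 2 = v + w by ring] at e1
    rw [show (u + v) / 2 + ((u - v) / 2 + s) = u + s by ring,
      show (u + v) / 2 - ((u - v) / 2 + s) = v - s by ring] at e2
    rw [show (u + v) / 2 + w + ((u - v) / 2 + s) = u + s + w by ring,
      show (u + v) / 2 + w - ((u - v) / 2 + s) = v - s + w by ring] at e3
    rw [show (u + v) / 2 + (u - v) / 2 = u by ring,
      show (u + v) / 2 - (u - v) / 2 = v by ring] at e4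
    simp only [A, B]
    rw [e1, e2, e3, e4]
    linear_combination (O ((u - v) / 2) * E ((u - v) / 2 + s) -
      E ((u - v) / 2) * O ((u - v) / 2 + s)) * hprop ((u + v) / 2)
  obtain ⟨v, hBv, hAv⟩ := exists_theta1_mul_theta1_add_ne_zero hτ w
  change B v ≠ 0 at hBv
  change A v ≠ 0 at hAv
  have hder : ∀ f : ℂ → ℂ, Differentiable ℂ f → ∀ u, HasDerivAt (fun s => f (u + s) * f (v - s))
      (deriv f u * f v - f u * deriv f v) 0 := by
    intro f hf u
    have h1 : HasDerivAt (fun s => f (u + s)) (deriv f u) 0 := by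
      have : HasDerivAt f (deriv f u) (u + 0) := by simpa using (hf u).hasDerivAt
      exact this.comp_const_add u 0
    have h2 : HasDerivAt (fun s => f (v - s)) (-deriv f v) 0 := by
      have : HasDerivAt f (deriv f v) (v - 0) := by simpa using (hf v).hasDerivAt
      exact this.comp_const_sub v 0
    refine (h1.mul h2).congr_deriv ?_
    simp only [add_zero, sub_zero]
    ring
  have hlog : ∀ u, A u * A v * (deriv B u * B v - B u * deriv B v) =
      (deriv A u * A v - A u * deriv A v) * (B u * B v) := by
    intro u
    have h1 := (hder B hB u).const_mul (A u * A v)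
    have h2 := (hder A hA u).mul_const (B u * B v)
    exact h1.unique (h2.congr_of_eventuallyEq (.of_forall fun s => hfun u v s))
  let c := deriv A v / A v - deriv B v / B v
  obtain ⟨K, hK⟩ := exists_mul_exp_eq_of_deriv_mul_sub hA hB (c := c) hBv (fun u => by
    simp only [c]
    field_simp
    linear_combination -hlog u)
  have hA1 : A (v + 1) = -A v := by
    simp only [A]; rw [show v + 1 + w = v + w + 1 by ring, theta1_add_one]
  have hAτ : A (v + τ) = -Complex.exp (-2 * Real.pi * I * (v + w) - Real.pi * I * τ) * A v := by
    simp only [A]; rw [show v + τ + w = v + w + τ by ring, theta1_add_tau]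
  have hc : Complex.exp (-c) = 1 := by
    have h0 := hK v
    have h1 := hK (v + 1)
    rw [hA1, show B (v + 1) = -B v from theta1_add_one v τ, mul_add, Complex.exp_add, mul_one] at h1
    refine mul_left_cancel₀ (mul_ne_zero hAv (Complex.exp_ne_zero (-c * v))) ?_
    linear_combination -h1 - h0
  have hcτ : Complex.exp (-2 * Real.pi * I * w + -c * τ) = 1 := by
    have h0 := hK v
    have h1 := hK (v + τ)
    rw [hAτ, show B (v + τ) = _ from theta1_add_tau v τ, mul_add (-c), Complex.exp_add (-c * v),
      show -2 * Real.pi * I * (v + w) - Real.pi * I * τ =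
        (-2 * Real.pi * I * v - Real.pi * I * τ) + -2 * Real.pi * I * w by ring,
      Complex.exp_add _ (-2 * Real.pi * I * w)] at h1
    rw [Complex.exp_add]
    refine mul_left_cancel₀ (mul_ne_zero (mul_ne_zero hAv (Complex.exp_ne_zero (-c * v)))
      (Complex.exp_ne_zero (-2 * Real.pi * I * v - Real.pi * I * τ))) ?_
    linear_combination -h1 - Complex.exp (-2 * Real.pi * I * v - Real.pi * I * τ) * h0
  obtain ⟨n, hn⟩ := Complex.exp_eq_one_iff.1 hc
  obtain ⟨m, hm⟩ := Complex.exp_eq_one_iff.1 hcτ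
  refine ⟨-m, n, mul_left_cancel₀ Complex.two_pi_I_ne_zero ?_⟩
  push_cast
  linear_combination -hm + τ * hn

lemma quasiperiodic_add_int {f : ℂ → ℂ} {s : ℂ} (hs : s ≠ 0) (h1 : ∀ z, f (z + 1) = s * f z)
    (m : ℤ) (z : ℂ) : f (z + m) = s ^ m * f z := by
  induction m with
  | zero => simp
  | succ i ih =>
    push_cast at ih ⊢
    rw [← add_assoc, h1, ih, zpow_add_one₀ hs]
    ring
  | pred i ih =>
    have := h1 (z + ((-i - 1 : ℤ) : ℂ))
    rw [show z + ((-i - 1 : ℤ) : ℂ) + 1 = z + ((-i : ℤ) : ℂ) by push_cast; ring, ih] at this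
    refine mul_left_cancel₀ hs ?_
    rw [← this, ← mul_assoc, ← zpow_one_add₀ hs]
    congr 2
    ring

lemma quasiperiodic_add_lattice {f : ℂ → ℂ} {τ s κ : ℂ} (hs : s ≠ 0)
    (h1 : ∀ z, f (z + 1) = s * f z)
    (hτ : ∀ z, f (z + τ) =
      s * Complex.exp (-2 * Real.pi * I * κ * z - Real.pi * I * κ * τ) * f z)
    (m n : ℤ) (z : ℂ) : f (z + (m + n * τ)) = s ^ (m + n) *
      Complex.exp (-2 * Real.pi * I * κ * n * z - Real.pi * I * κ * n ^ 2 * τ -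
        2 * Real.pi * I * κ * n * m) * f z := by
  have key : ∀ z, f (z + n * τ) = s ^ n *
      Complex.exp (-2 * Real.pi * I * κ * n * z - Real.pi * I * κ * n ^ 2 * τ) * f z := by
    intro z
    induction n with
    | zero => simp
    | succ i ih =>
      push_cast at ih ⊢
      rw [add_mul, one_mul, ← add_assoc, hτ, ih, zpow_add_one₀ hs]
      have : Complex.exp (-2 * Real.pi * I * κ * (i + 1) * z - Real.pi * I * κ * (i + 1) ^ 2 * τ) =
          Complex.exp (-2 * Real.pi * I * κ * (z + i * τ) - Real.pi * I * κ * τ) *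
          Complex.exp (-2 * Real.pi * I * κ * i * z - Real.pi * I * κ * i ^ 2 * τ) := by
        rw [← Complex.exp_add]; congr 1; ring
      rw [this]
      ring
    | pred i ih =>
      have := hτ (z + ((-i - 1 : ℤ) : ℂ) * τ)
      rw [show z + ((-i - 1 : ℤ) : ℂ) * τ + τ = z + ((-i : ℤ) : ℂ) * τ by push_cast; ring, ih] at this
      refine mul_left_cancel₀ (mul_ne_zero hs (Complex.exp_ne_zero (-2 * Real.pi * I * κ *
        (z + ((-i - 1 : ℤ) : ℂ) * τ) - Real.pi * I * κ * τ))) ?_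
      rw [← this]
      have h2 : Complex.exp (-2 * Real.pi * I * κ * (-i : ℤ) * z -
            Real.pi * I * κ * (-i : ℤ) ^ 2 * τ) =
          Complex.exp (-2 * Real.pi * I * κ * (z + ((-i - 1 : ℤ) : ℂ) * τ) - Real.pi * I * κ * τ) *
          Complex.exp (-2 * Real.pi * I * κ * (-i - 1 : ℤ) * z -
            Real.pi * I * κ * (-i - 1 : ℤ) ^ 2 * τ) := by
        rw [← Complex.exp_add]; congr 1; push_cast; ring
      have h3 : s ^ (-i : ℤ) = s * s ^ (-i - 1 : ℤ) := by
        rw [← zpow_one_add₀ hs]; congr 1; ring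
      rw [h2, h3]
      ring
  rw [show z + (m + n * τ) = z + m + n * τ by ring, key, quasiperiodic_add_int hs h1, zpow_add₀ hs,
    show -2 * Real.pi * I * κ * n * (z + m) - Real.pi * I * κ * n ^ 2 * τ =
      -2 * Real.pi * I * κ * n * z - Real.pi * I * κ * n ^ 2 * τ -
        2 * Real.pi * I * κ * n * m by ring]
  ring

lemma theta1_add_lattice (τ : ℂ) (m n : ℤ) (z : ℂ) : theta1 (z + (m + n * τ)) τ =
    (-1) ^ (m + n) * Complex.exp (-2 * Real.pi * I * n * z - Real.pi * I * n ^ 2 * τ -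
      2 * Real.pi * I * n * m) * theta1 z τ := by
  have := quasiperiodic_add_lattice (f := fun z => theta1 z τ) (τ := τ) (s := -1) (κ := 1)
    (by norm_num) (fun z => by rw [theta1_add_one]; ring)
    (fun z => by rw [theta1_add_tau]; simp only [mul_one]; ring) m n z
  simpa only [mul_one] using this

lemma VkSet_add_lattice {τ : ℂ} {k : ℕ} {f : ℂ → ℂ} (hf : f ∈ VkSet τ k) (m n : ℤ) (z : ℂ) :
    f (z + (m + n * τ)) = Complex.exp (-2 * Real.pi * I * k * n * z -
      Real.pi * I * k * n ^ 2 * τ - 2 * Real.pi * I * k * n * m) * f z := by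
  have := quasiperiodic_add_lattice (f := f) (τ := τ) (s := 1) (κ := k)
    one_ne_zero (fun z => by rw [hf.2.1]; ring) (fun z => by rw [hf.2.2]; ring) m n z
  simpa only [one_zpow, one_mul] using this

lemma theta1_zero (τ : ℂ) : theta1 0 τ = 0 := by
  have := theta1_neg 0 τ
  rw [neg_zero] at this
  exact self_eq_neg.1 this

lemma theta1_eq_zero_iff {τ : ℂ} (hτ : 0 < τ.im) (w : ℂ) : theta1 w τ = 0 ↔ w ∈ lattice τ := by
  refine ⟨mem_lattice_of_theta1_eq_zero hτ, ?_⟩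
  rintro ⟨m, n, rfl⟩
  have := theta1_add_lattice τ m n 0
  rwa [zero_add, theta1_zero, mul_zero] at this

lemma deriv_theta1_ne_zero {τ : ℂ} (hτ : 0 < τ.im) (h0 : theta1'0 τ ≠ 0) {w : ℂ}
    (hw : theta1 w τ = 0) : deriv (fun z => theta1 z τ) w ≠ 0 := by
  obtain ⟨m, n, rfl⟩ := mem_lattice_of_theta1_eq_zero hτ hw
  have hθ := differentiable_theta1 hτ
  let e : ℂ → ℂ := fun z => (-1) ^ (m + n) * Complex.exp (-2 * Real.pi * I * n * z -
    Real.pi * I * n ^ 2 * τ - 2 * Real.pi * I * n * m)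
  have he : Differentiable ℂ e := by fun_prop
  have h1 : HasDerivAt (fun z => theta1 (z + (m + n * τ)) τ) (e 0 * theta1'0 τ) 0 := by
    have := (he 0).hasDerivAt.mul (hθ 0).hasDerivAt
    rw [theta1_zero, mul_zero, zero_add] at this
    exact this.congr_of_eventuallyEq (.of_forall fun z => theta1_add_lattice τ m n z)
  have h2 : HasDerivAt (fun z => theta1 (z + (m + n * τ)) τ)
      (deriv (fun z => theta1 z τ) (m + n * τ)) 0 := by
    have : HasDerivAt (fun z => theta1 z τ) (deriv (fun z => theta1 z τ) (m + n * τ))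
      (0 + (m + n * τ)) := by simpa using (hθ (m + n * τ)).hasDerivAt
    exact this.comp_add_const 0 _
  rw [h2.unique h1]
  exact mul_ne_zero (mul_ne_zero (zpow_ne_zero _ (by norm_num)) (Complex.exp_ne_zero _)) h0

/-- A quotient of entire functions whose denominator has only simple zeros, all of them zeros of
the numerator, extends to an entire function. -/
lemma differentiable_div_of_simple_zeros {f d : ℂ → ℂ} (hf : Differentiable ℂ f)
    (hd : Differentiable ℂ d) (h : ∀ a, d a = 0 → f a = 0 ∧ deriv d a ≠ 0) :
    Differentiable ℂ (fun z => if d z = 0 then deriv f z / deriv d z else f z / d z) := by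
  intro a
  by_cases ha : d a = 0
  · obtain ⟨hfa, hda⟩ := h a ha
    have hF : Differentiable ℂ (dslope f a) := by
      rw [← differentiableOn_univ]
      exact (Complex.differentiableOn_dslope Filter.univ_mem).2 hf.differentiableOn
    have hD : Differentiable ℂ (dslope d a) := by
      rw [← differentiableOn_univ]
      exact (Complex.differentiableOn_dslope Filter.univ_mem).2 hd.differentiableOn
    have hDa : dslope d a a ≠ 0 := by rwa [dslope_same]
    refine ((hF a).div (hD a) hDa).congr_of_eventuallyEq ?_
    filter_upwards [hD.continuous.continuousAt.eventually_ne hDa] with z hz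
    rcases eq_or_ne z a with rfl | hza
    · simp [ha]
    · have hsub : z - a ≠ 0 := sub_ne_zero.2 hza
      have e1 : f z = (z - a) * dslope f a z := by
        simpa [hfa] using (sub_smul_dslope f a z).symm
      have e2 : d z = (z - a) * dslope d a z := by
        simpa [ha] using (sub_smul_dslope d a z).symm
      have hdz : d z ≠ 0 := by rw [e2]; exact mul_ne_zero hsub hz
      simp only [hdz, if_false, Pi.div_apply]
      rw [e1, e2, mul_div_mul_left _ _ hsub]
  · refine ((hf a).div (hd a) ha).congr_of_eventuallyEq ?_
    filter_upwards [hd.continuous.continuousAt.eventually_ne ha] with z hz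
    simp [hz]

lemma deriv_fst_eq_neg_deriv_snd {N : ℂ × ℂ → ℂ} (hN : Differentiable ℂ N) {x y : ℂ}
    (h : ∀ t, N (x + t, y + t) = 0) :
    deriv (fun u => N (u, y)) x = -deriv (fun u => N (x, u)) y := by
  have hN' : HasFDerivAt N (fderiv ℂ N (x, y)) (x, y) := (hN (x, y)).hasFDerivAt
  have h1 : HasDerivAt (fun u => N (u, y)) (fderiv ℂ N (x, y) (1, 0)) x :=
    hN'.comp_hasDerivAt x ((hasDerivAt_id x).prodMk (hasDerivAt_const x y))
  have h2 : HasDerivAt (fun u => N (x, u)) (fderiv ℂ N (x, y) (0, 1)) y :=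
    hN'.comp_hasDerivAt y ((hasDerivAt_const y x).prodMk (hasDerivAt_id y))
  have h3 : HasDerivAt (fun t => N (x + t, y + t)) (fderiv ℂ N (x, y) (1, 1)) 0 := by
    have hN0 : HasFDerivAt N (fderiv ℂ N (x, y)) (x + 0, y + 0) := by simpa using hN'
    exact HasFDerivAt.comp_hasDerivAt (f := fun t : ℂ => (x + t, y + t)) 0 hN0
      (((hasDerivAt_id 0).const_add x).prodMk ((hasDerivAt_id 0).const_add y))
  have h4 : fderiv ℂ N (x, y) (1, 1) = 0 := by
    refine h3.unique ?_
    simp only [h]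
    exact hasDerivAt_const _ _
  rw [h1.deriv, h2.deriv, eq_neg_iff_add_eq_zero, ← map_add]
  simpa using h4

lemma countable_lattice (τ : ℂ) : (lattice τ).Countable := by
  refine (Set.countable_range fun p : ℤ × ℤ => (p.1 : ℂ) + p.2 * τ).mono ?_
  rintro w ⟨m, n, rfl⟩
  exact ⟨(m, n), rfl⟩

lemma eq_of_eq_of_theta1_ne_zero {τ : ℂ} (hτ : 0 < τ.im) {φ p q : ℂ → ℂ}
    (hφ : Function.Injective φ) (hp : Continuous p) (hq : Continuous q)
    (h : ∀ z, theta1 (φ z) τ ≠ 0 → p z = q z) (z : ℂ) : p z = q z := by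
  have hd : Dense (φ ⁻¹' lattice τ)ᶜ :=
    Set.Countable.dense_compl ℂ ((countable_lattice τ).preimage hφ)
  exact congrFun (Continuous.ext_on hd hp hq fun z hz =>
    h z fun h0 => hz ((theta1_eq_zero_iff hτ _).1 h0)) z

lemma theta1_sub_one (z τ : ℂ) : theta1 (z - 1) τ = -theta1 z τ := by
  have := theta1_add_one (z - 1) τ
  rw [sub_add_cancel] at this
  rw [this, neg_neg]

lemma theta1_sub_tau (z τ : ℂ) :
    theta1 (z - τ) τ = -Complex.exp (2 * Real.pi * I * z - Real.pi * I * τ) * theta1 z τ := by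
  rw [show z - τ = -(-z + τ) by ring, theta1_neg, theta1_add_tau, theta1_neg,
    show -2 * Real.pi * I * -z = 2 * Real.pi * I * z by ring]
  ring

/-- The numerator of the modified `R`-operator after clearing the denominators
`θ₁(-μ) θ₁(-ξ) θ₁(z₁₂ + (μ+ξ)/k)`. -/
noncomputable def modifiedRNumerator (τ : ℂ) (k : ℕ) (μ ξ : ℂ) (g h : ℂ → ℂ) (p : ℂ × ℂ) : ℂ :=
  theta1 (p.1 - p.2 + (μ + ξ) / k - μ) τ * theta1 (-ξ) τ * g (p.1 + μ / k) * h (p.2 - μ / k) -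
    theta1 (p.1 - p.2 + (μ + ξ) / k - ξ) τ * theta1 (-μ) τ * g (p.2 - ξ / k) * h (p.1 + ξ / k)

section Numerator

variable {τ : ℂ} {k : ℕ} {μ ξ : ℂ} {g h : ℂ → ℂ}

lemma differentiable_modifiedRNumerator (hτ : 0 < τ.im) (hg : g ∈ VkSet τ k) (hh : h ∈ VkSet τ k) :
    Differentiable ℂ (modifiedRNumerator τ k μ ξ g h) := by
  have hθ := differentiable_theta1 hτ
  have hg := hg.1
  have hh := hh.1
  have e1 : Differentiable ℂ fun p : ℂ × ℂ => theta1 (p.1 - p.2 + (μ + ξ) / k - μ) τ :=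
    hθ.comp (g := fun z => theta1 z τ) (by fun_prop)
  have e2 : Differentiable ℂ fun p : ℂ × ℂ => theta1 (p.1 - p.2 + (μ + ξ) / k - ξ) τ :=
    hθ.comp (g := fun z => theta1 z τ) (by fun_prop)
  unfold modifiedRNumerator
  fun_prop

lemma modifiedRNumerator_eq_zero (hτ : 0 < τ.im) (hk : 0 < k) (hg : g ∈ VkSet τ k)
    (hh : h ∈ VkSet τ k) {x y : ℂ} (hw : theta1 (x - y + (μ + ξ) / k) τ = 0) :
    modifiedRNumerator τ k μ ξ g h (x, y) = 0 := by
  have hk' : (k : ℂ) ≠ 0 := Nat.cast_ne_zero.2 hk.ne'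
  obtain ⟨m, n, hmn⟩ := mem_lattice_of_theta1_eq_zero hτ hw
  have hx : x = y - (μ + ξ) / k + (m + n * τ) := by linear_combination hmn
  have hμ : x - y + (μ + ξ) / k - μ = -μ + (m + n * τ) := by rw [hmn]; ring
  have hξ : x - y + (μ + ξ) / k - ξ = -ξ + (m + n * τ) := by rw [hmn]; ring
  have hxμ : x + μ / k = y - ξ / k + (m + n * τ) := by rw [hx]; ring
  have hxξ : x + ξ / k = y - μ / k + (m + n * τ) := by rw [hx]; ring
  simp only [modifiedRNumerator]
  rw [hμ, hξ, hxμ, hxξ, theta1_add_lattice, theta1_add_lattice, VkSet_add_lattice hg,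
    VkSet_add_lattice hh]
  have key : Complex.exp (-2 * Real.pi * I * n * -μ - Real.pi * I * n ^ 2 * τ -
        2 * Real.pi * I * n * m) *
      Complex.exp (-2 * Real.pi * I * k * n * (y - ξ / k) -
        Real.pi * I * k * n ^ 2 * τ - 2 * Real.pi * I * k * n * m) =
      Complex.exp (-2 * Real.pi * I * n * -ξ - Real.pi * I * n ^ 2 * τ -
        2 * Real.pi * I * n * m) *
      Complex.exp (-2 * Real.pi * I * k * n * (y - μ / k) -
        Real.pi * I * k * n ^ 2 * τ - 2 * Real.pi * I * k * n * m) := by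
    rw [← Complex.exp_add, ← Complex.exp_add]
    congr 1
    field_simp
    ring
  linear_combination ((-1) ^ (m + n) * theta1 (-μ) τ * theta1 (-ξ) τ * g (y - ξ / k) *
    h (y - μ / k)) * key

lemma modifiedRNumerator_add_one_fst (hg : g ∈ VkSet τ k) (hh : h ∈ VkSet τ k) (x y : ℂ) :
    modifiedRNumerator τ k μ ξ g h (x + 1, y) = -modifiedRNumerator τ k μ ξ g h (x, y) := by
  simp only [modifiedRNumerator]
  rw [show x + 1 - y + (μ + ξ) / k - μ = x - y + (μ + ξ) / k - μ + 1 by ring,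
    show x + 1 - y + (μ + ξ) / k - ξ = x - y + (μ + ξ) / k - ξ + 1 by ring,
    show x + 1 + μ / k = x + μ / k + 1 by ring, show x + 1 + ξ / k = x + ξ / k + 1 by ring,
    theta1_add_one, theta1_add_one, hg.2.1, hh.2.1]
  ring

lemma modifiedRNumerator_add_one_snd (hg : g ∈ VkSet τ k) (hh : h ∈ VkSet τ k) (x y : ℂ) :
    modifiedRNumerator τ k μ ξ g h (x, y + 1) = -modifiedRNumerator τ k μ ξ g h (x, y) := by
  simp only [modifiedRNumerator]
  rw [show x - (y + 1) + (μ + ξ) / k - μ = x - y + (μ + ξ) / k - μ - 1 by ring,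
    show x - (y + 1) + (μ + ξ) / k - ξ = x - y + (μ + ξ) / k - ξ - 1 by ring,
    show y + 1 - μ / k = y - μ / k + 1 by ring, show y + 1 - ξ / k = y - ξ / k + 1 by ring,
    theta1_sub_one, theta1_sub_one, hg.2.1, hh.2.1]
  ring

lemma modifiedRNumerator_add_tau_fst (hk : 0 < k) (hg : g ∈ VkSet τ k) (hh : h ∈ VkSet τ k)
    (x y : ℂ) : modifiedRNumerator τ k μ ξ g h (x + τ, y) =
      -Complex.exp (-2 * Real.pi * I * (x - y + (μ + ξ) / k) - Real.pi * I * τ) *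
        Complex.exp (-2 * Real.pi * I * k * x - Real.pi * I * k * τ) *
        modifiedRNumerator τ k μ ξ g h (x, y) := by
  have hk' : (k : ℂ) ≠ 0 := Nat.cast_ne_zero.2 hk.ne'
  have key : ∀ c : ℂ,
      Complex.exp (-2 * Real.pi * I * (x - y + (μ + ξ) / k - c) - Real.pi * I * τ) *
        Complex.exp (-2 * Real.pi * I * k * (x + c / k) - Real.pi * I * k * τ) =
      Complex.exp (-2 * Real.pi * I * (x - y + (μ + ξ) / k) - Real.pi * I * τ) *
        Complex.exp (-2 * Real.pi * I * k * x - Real.pi * I * k * τ) := by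
    intro c
    rw [← Complex.exp_add, ← Complex.exp_add]
    congr 1
    field_simp
    ring
  simp only [modifiedRNumerator]
  rw [show x + τ - y + (μ + ξ) / k - μ = x - y + (μ + ξ) / k - μ + τ by ring,
    show x + τ - y + (μ + ξ) / k - ξ = x - y + (μ + ξ) / k - ξ + τ by ring,
    show x + τ + μ / k = x + μ / k + τ by ring, show x + τ + ξ / k = x + ξ / k + τ by ring,
    theta1_add_tau, theta1_add_tau, hg.2.2, hh.2.2]
  linear_combination
    -(theta1 (x - y + (μ + ξ) / k - μ) τ * theta1 (-ξ) τ * g (x + μ / k) * h (y - μ / k)) * key μ +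
    (theta1 (x - y + (μ + ξ) / k - ξ) τ * theta1 (-μ) τ * g (y - ξ / k) * h (x + ξ / k)) * key ξ

lemma modifiedRNumerator_add_tau_snd (hk : 0 < k) (hg : g ∈ VkSet τ k) (hh : h ∈ VkSet τ k)
    (x y : ℂ) : modifiedRNumerator τ k μ ξ g h (x, y + τ) =
      -Complex.exp (2 * Real.pi * I * (x - y + (μ + ξ) / k) - Real.pi * I * τ) *
        Complex.exp (-2 * Real.pi * I * k * y - Real.pi * I * k * τ) *
        modifiedRNumerator τ k μ ξ g h (x, y) := by
  have hk' : (k : ℂ) ≠ 0 := Nat.cast_ne_zero.2 hk.ne'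
  have key : ∀ c : ℂ,
      Complex.exp (2 * Real.pi * I * (x - y + (μ + ξ) / k - c) - Real.pi * I * τ) *
        Complex.exp (-2 * Real.pi * I * k * (y - c / k) - Real.pi * I * k * τ) =
      Complex.exp (2 * Real.pi * I * (x - y + (μ + ξ) / k) - Real.pi * I * τ) *
        Complex.exp (-2 * Real.pi * I * k * y - Real.pi * I * k * τ) := by
    intro c
    rw [← Complex.exp_add, ← Complex.exp_add]
    congr 1
    field_simp
    ring
  simp only [modifiedRNumerator]
  rw [show x - (y + τ) + (μ + ξ) / k - μ = x - y + (μ + ξ) / k - μ - τ by ring,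
    show x - (y + τ) + (μ + ξ) / k - ξ = x - y + (μ + ξ) / k - ξ - τ by ring,
    show y + τ - μ / k = y - μ / k + τ by ring, show y + τ - ξ / k = y - ξ / k + τ by ring,
    theta1_sub_tau, theta1_sub_tau, hg.2.2, hh.2.2]
  linear_combination
    -(theta1 (x - y + (μ + ξ) / k - μ) τ * theta1 (-ξ) τ * g (x + μ / k) * h (y - μ / k)) * key μ +
    (theta1 (x - y + (μ + ξ) / k - ξ) τ * theta1 (-μ) τ * g (y - ξ / k) * h (x + ξ / k)) * key ξ

end Numerator

/-- the modified elliptic R-operator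
R_k(ξ)f(z₁,z₂) = σ_μ(z₁₂+(μ+ξ)/k)f(z₁+μ/k, z₂−μ/k) − σ_ξ(z₁₂+(μ+ξ)/k)f(z₂−ξ/k, z₁+ξ/k)
preserves V_k ⊗ V_k: for g, h ∈ V_k, the function R_k(ξ)(g⊗h) extends to a function
lying in V_k in each variable separately. -/
theorem modified_R_preserves_Vk (τ : ℂ) (hτ : 0 < τ.im) (k : ℕ) (hk : 0 < k)
    (μ ξ : ℂ) (hμ : μ ∉ lattice τ) (hξ : ξ ∉ lattice τ)
    (g h : ℂ → ℂ) (hg : g ∈ VkSet τ k) (hh : h ∈ VkSet τ k) :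
    ∃ G : ℂ → ℂ → ℂ,
      (∀ z2, (fun z1 => G z1 z2) ∈ VkSet τ k) ∧
      (∀ z1, (fun z2 => G z1 z2) ∈ VkSet τ k) ∧
      ∀ z1 z2, z1 - z2 + (μ + ξ) / k ∉ lattice τ →
        G z1 z2 =
          sigmaE τ μ (z1 - z2 + (μ + ξ) / k) * g (z1 + μ / k) * h (z2 - μ / k) -
          sigmaE τ ξ (z1 - z2 + (μ + ξ) / k) * g (z2 - ξ / k) * h (z1 + ξ / k) := by
  have hμ0 : theta1 (-μ) τ ≠ 0 := by
    rw [theta1_neg, neg_ne_zero]; exact fun h0 => hμ ((theta1_eq_zero_iff hτ μ).1 h0)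
  have hξ0 : theta1 (-ξ) τ ≠ 0 := by
    rw [theta1_neg, neg_ne_zero]; exact fun h0 => hξ ((theta1_eq_zero_iff hτ ξ).1 h0)
  by_cases h0 : theta1'0 τ = 0
  · refine ⟨fun _ _ => 0, fun _ => ?_, fun _ => ?_, fun z1 z2 _ => by simp [sigmaE, h0]⟩ <;>
      exact ⟨differentiable_const _, fun _ => rfl, fun _ => (mul_zero _).symm⟩
  set N := modifiedRNumerator τ k μ ξ g h with hNdef
  have hN : Differentiable ℂ N := differentiable_modifiedRNumerator hτ hg hh
  have hθ := differentiable_theta1 hτ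
  let Q : ℂ → ℂ → ℂ := fun x y => if theta1 (x - y + (μ + ξ) / k) τ = 0 then
    deriv (fun u => N (u, y)) x / deriv (fun u => theta1 u τ) (x - y + (μ + ξ) / k)
    else N (x, y) / theta1 (x - y + (μ + ξ) / k) τ
  have hQ : ∀ {x y}, theta1 (x - y + (μ + ξ) / k) τ ≠ 0 →
      Q x y = N (x, y) / theta1 (x - y + (μ + ξ) / k) τ := fun hw => if_neg hw
  have hNzero : ∀ {x y}, theta1 (x - y + (μ + ξ) / k) τ = 0 → N (x, y) = 0 :=
    fun hw => modifiedRNumerator_eq_zero hτ hk hg hh hw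
  have hQ1 : ∀ y, Differentiable ℂ fun x => Q x y := by
    intro y
    have hd : ∀ x, deriv (fun x => theta1 (x - y + (μ + ξ) / k) τ) x =
        deriv (fun u => theta1 u τ) (x - y + (μ + ξ) / k) := by
      intro x
      have := ((hθ (x - y + (μ + ξ) / k)).hasDerivAt.comp x
        (((hasDerivAt_id x).sub_const y).add_const ((μ + ξ) / k))).deriv
      rw [mul_one] at this
      exact this
    have := differentiable_div_of_simple_zeros (f := fun x => N (x, y))
      (d := fun x => theta1 (x - y + (μ + ξ) / k) τ) (by fun_prop)
      (hθ.comp (by fun_prop : Differentiable ℂ fun x : ℂ => x - y + (μ + ξ) / k))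
      (fun x hx => ⟨hNzero hx, by rw [hd]; exact deriv_theta1_ne_zero hτ h0 hx⟩)
    simpa only [hd] using this
  have hQ2 : ∀ x, Differentiable ℂ fun y => Q x y := by
    intro x
    have hd : ∀ y, deriv (fun y => theta1 (x - y + (μ + ξ) / k) τ) y =
        -deriv (fun u => theta1 u τ) (x - y + (μ + ξ) / k) := by
      intro y
      have := ((hθ (x - y + (μ + ξ) / k)).hasDerivAt.comp y
        (((hasDerivAt_id y).const_sub x).add_const ((μ + ξ) / k))).deriv
      rw [mul_neg, mul_one] at this
      exact this
    have := differentiable_div_of_simple_zeros (f := fun y => N (x, y))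
      (d := fun y => theta1 (x - y + (μ + ξ) / k) τ) (by fun_prop)
      (hθ.comp (by fun_prop : Differentiable ℂ fun y : ℂ => x - y + (μ + ξ) / k))
      (fun y hy => ⟨hNzero hy, by rw [hd, neg_ne_zero]; exact deriv_theta1_ne_zero hτ h0 hy⟩)
    convert this using 2 with y
    simp only [Q]
    split_ifs with hw
    · rw [hd, deriv_fst_eq_neg_deriv_snd hN (fun t => hNzero ?_), neg_div, div_neg]
      rwa [add_sub_add_right_eq_sub]
    · rfl
  have hinj1 : ∀ y, Function.Injective fun x : ℂ => x - y + (μ + ξ) / k :=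
    fun y a b hab => by simpa using hab
  have hinj2 : ∀ x, Function.Injective fun y : ℂ => x - y + (μ + ξ) / k :=
    fun x a b hab => by simpa using hab
  let C := theta1'0 τ / (theta1 (-μ) τ * theta1 (-ξ) τ)
  refine ⟨fun x y => C * Q x y, fun y => ⟨(hQ1 y).const_mul C, ?_, ?_⟩,
    fun x => ⟨(hQ2 x).const_mul C, ?_, ?_⟩, fun x y hxy => ?_⟩
  · have hc := (hQ1 y).continuous
    refine eq_of_eq_of_theta1_ne_zero hτ (hinj1 y) (by fun_prop) (by fun_prop) fun x hw => ?_
    have hs : theta1 (x + 1 - y + (μ + ξ) / k) τ = -theta1 (x - y + (μ + ξ) / k) τ := by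
      rw [← theta1_add_one]; congr 1; ring
    beta_reduce
    rw [hQ hw, hQ (by rw [hs]; exact neg_ne_zero.2 hw), hs, hNdef,
      modifiedRNumerator_add_one_fst hg hh, neg_div_neg_eq]
  · have hc := (hQ1 y).continuous
    refine eq_of_eq_of_theta1_ne_zero hτ (hinj1 y) (by fun_prop) (by fun_prop) fun x hw => ?_
    have hs : theta1 (x + τ - y + (μ + ξ) / k) τ =
        -Complex.exp (-2 * Real.pi * I * (x - y + (μ + ξ) / k) - Real.pi * I * τ) *
          theta1 (x - y + (μ + ξ) / k) τ := by
      rw [← theta1_add_tau]; congr 1; ring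
    have he := neg_ne_zero.2
      (Complex.exp_ne_zero (-2 * Real.pi * I * (x - y + (μ + ξ) / k) - Real.pi * I * τ))
    beta_reduce
    rw [hQ hw, hQ (by rw [hs]; exact mul_ne_zero he hw), hs, hNdef,
      modifiedRNumerator_add_tau_fst hk hg hh, mul_assoc (-Complex.exp _),
      mul_div_mul_left _ _ he]
    ring
  · have hc := (hQ2 x).continuous
    refine eq_of_eq_of_theta1_ne_zero hτ (hinj2 x) (by fun_prop) (by fun_prop) fun y hw => ?_
    have hs : theta1 (x - (y + 1) + (μ + ξ) / k) τ = -theta1 (x - y + (μ + ξ) / k) τ := by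
      rw [← theta1_sub_one]; congr 1; ring
    beta_reduce
    rw [hQ hw, hQ (by rw [hs]; exact neg_ne_zero.2 hw), hs, hNdef,
      modifiedRNumerator_add_one_snd hg hh, neg_div_neg_eq]
  · have hc := (hQ2 x).continuous
    refine eq_of_eq_of_theta1_ne_zero hτ (hinj2 x) (by fun_prop) (by fun_prop) fun y hw => ?_
    have hs : theta1 (x - (y + τ) + (μ + ξ) / k) τ =
        -Complex.exp (2 * Real.pi * I * (x - y + (μ + ξ) / k) - Real.pi * I * τ) *
          theta1 (x - y + (μ + ξ) / k) τ := by
      rw [← theta1_sub_tau]; congr 1; ring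
    have he := neg_ne_zero.2
      (Complex.exp_ne_zero (2 * Real.pi * I * (x - y + (μ + ξ) / k) - Real.pi * I * τ))
    beta_reduce
    rw [hQ hw, hQ (by rw [hs]; exact mul_ne_zero he hw), hs, hNdef,
      modifiedRNumerator_add_tau_snd hk hg hh, mul_assoc (-Complex.exp _),
      mul_div_mul_left _ _ he]
    ring
  · have hw : theta1 (x - y + (μ + ξ) / k) τ ≠ 0 :=
      fun hw => hxy ((theta1_eq_zero_iff hτ _).1 hw)
    simp only [hQ hw, hNdef, C, modifiedRNumerator, sigmaE]
    generalize theta1 (x - y + (μ + ξ) / k) τ = T at hw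
    field_simp
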